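/- Let T be a stratified ELI⊥⪯-TBox, A an ABox, I a model of (A,T), and let ρ = ρ₁⋯ρ_ℓ be an accepting run of the nested NFA 𝔄_A (constructed for a concept name A from T) in I starting from a^I, where ρ_i = (d_{i-1}, (q_{i-1},w_i,q_i), d_i) and q_i = (premise_i, goal_i). Then for every index i (proved by backward induction from i=ℓ to i=0): if d_i satisfies in I all concepts of premise_i, then d_i also satisfies goal_i in I. -/

import Mathlib

set_option autoImplicit false

/-! Core definitions for the description logic ELI-bot with stratification. -/

/-- Roles: role names and their inverses. -/
inductive DLRole (ρ : Type) : Type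
  | pos (r : ρ)
  | inv (r : ρ)

/-- The inverse of a (possibly inverted) role. -/
def DLRole.flip {ρ : Type} : DLRole ρ → DLRole ρ
  | .pos r => .inv r
  | .inv r => .pos r

/-- ELI-bot concepts over concept names `γ` and role names `ρ`. -/
inductive DLConcept (γ ρ : Type) : Type
  | bot
  | top
  | name (A : γ)
  | conj (C D : DLConcept γ ρ)
  | ex (s : DLRole ρ) (C : DLConcept γ ρ)

/-- Assertions: concept assertions `C(a)` and role assertions `s(a,b)`. -/
inductive DLAssertion (γ ρ ι : Type) : Type
  | conc (C : DLConcept γ ρ) (a : ι)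
  | role (s : DLRole ρ) (a b : ι)

/-- A general concept inclusion `lhs ⊑ rhs`. -/
structure DLGCI (γ ρ : Type) where
  lhs : DLConcept γ ρ
  rhs : DLConcept γ ρ

/-- Interpretations. -/
structure DLInterp (γ ρ ι : Type) where
  Dom : Type
  inh : Nonempty Dom
  iInd : ι → Dom
  iC : γ → Set Dom
  iR : ρ → Set (Dom × Dom)

variable {γ ρ ι : Type}

def DLInterp.role (I : DLInterp γ ρ ι) : DLRole ρ → Set (I.Dom × I.Dom)
  | .pos r => I.iR r
  | .inv r => {p | (p.2, p.1) ∈ I.iR r}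

def DLInterp.conc (I : DLInterp γ ρ ι) : DLConcept γ ρ → Set I.Dom
  | .bot => ∅
  | .top => Set.univ
  | .name A => I.iC A
  | .conj C D => I.conc C ∩ I.conc D
  | .ex s C => {d | ∃ e, (d, e) ∈ I.role s ∧ e ∈ I.conc C}

def DLInterp.satA (I : DLInterp γ ρ ι) : DLAssertion γ ρ ι → Prop
  | .conc C a => I.iInd a ∈ I.conc C
  | .role s a b => (I.iInd a, I.iInd b) ∈ I.role s

def DLInterp.satG (I : DLInterp γ ρ ι) (g : DLGCI γ ρ) : Prop :=
  I.conc g.lhs ⊆ I.conc g.rhs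

/-- `I` is a model of the KB `(AB, T)`. -/
def DLModels (I : DLInterp γ ρ ι) (AB : Set (DLAssertion γ ρ ι))
    (T : Set (DLGCI γ ρ)) : Prop :=
  (∀ α ∈ AB, I.satA α) ∧ (∀ g ∈ T, I.satG g)

/-- Entailment: every model of `(AB, T)` satisfies `α`. -/
def DLEntails (AB : Set (DLAssertion γ ρ ι)) (T : Set (DLGCI γ ρ))
    (α : DLAssertion γ ρ ι) : Prop :=
  ∀ I : DLInterp γ ρ ι, DLModels I AB T → I.satA α

/-- Atomic concepts: concept names, `⊤` and `⊥`. -/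
def DLConcept.Atomic : DLConcept γ ρ → Prop
  | .bot => True
  | .top => True
  | .name _ => True
  | .conj _ _ => False
  | .ex _ _ => False

/-- Concept names or `⊤` (no `⊥`). -/
def DLConcept.AtomNB : DLConcept γ ρ → Prop
  | .bot => False
  | .top => True
  | .name _ => True
  | .conj _ _ => False
  | .ex _ _ => False

/-- Normal form of GCIs: `A ⊑ B`, `A ⊓ B ⊑ C`, `A ⊑ ∃s.B`, `∃s.A ⊑ B`. -/
def DLGCI.Normal (g : DLGCI γ ρ) : Prop :=
  (g.lhs.Atomic ∧ g.rhs.Atomic) ∨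
  ((∃ A B : γ, g.lhs = .conj (.name A) (.name B)) ∧ g.rhs.Atomic) ∨
  (g.lhs.Atomic ∧ ∃ (s : DLRole ρ) (B : DLConcept γ ρ), g.rhs = .ex s B ∧ B.AtomNB) ∨
  ((∃ (s : DLRole ρ) (A : DLConcept γ ρ), g.lhs = .ex s A ∧ A.AtomNB) ∧ g.rhs.Atomic)

def NormalTBox (T : Set (DLGCI γ ρ)) : Prop := ∀ g ∈ T, g.Normal

/-- Symbols: concept names and (possibly inverted) roles, the carriers of the preorder. -/
inductive DLSym (γ ρ : Type) : Type
  | c (A : γ)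
  | r (s : DLRole ρ)

/-- Strict part of a preorder. -/
def StrictOf (le : DLSym γ ρ → DLSym γ ρ → Prop) (x y : DLSym γ ρ) : Prop :=
  le x y ∧ ¬ le y x

/-- `le` witnesses that the normal-form TBox `T` is stratified. -/
def StratifiedWith (T : Set (DLGCI γ ρ)) (le : DLSym γ ρ → DLSym γ ρ → Prop) : Prop :=
  Reflexive le ∧ Transitive le ∧
  (∀ A B : γ, (⟨.name A, .name B⟩ : DLGCI γ ρ) ∈ T → le (.c A) (.c B)) ∧
  (∀ A B C : γ, (⟨.conj (.name A) (.name B), .name C⟩ : DLGCI γ ρ) ∈ T →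
      le (.c A) (.c C) ∧ le (.c B) (.c C) ∧
        (StrictOf le (.c A) (.c C) ∨ StrictOf le (.c B) (.c C))) ∧
  (∀ (A : γ) (s : DLRole ρ) (D : DLConcept γ ρ),
      (⟨.name A, .ex s D⟩ : DLGCI γ ρ) ∈ T →
        (∀ Dn : γ, D = .name Dn → le (.c A) (.c Dn)) ∧ le (.c A) (.r s)) ∧
  (∀ (B : γ) (s : DLRole ρ) (D : DLConcept γ ρ),
      (⟨.ex s D, .name B⟩ : DLGCI γ ρ) ∈ T →
        ∀ Dn : γ, D = .name Dn →
          (StrictOf le (.c Dn) (.c B) ∨ Dn = B) ∧ le (.r s) (.c Dn)) ∧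
  (∀ r : ρ, le (.r (.pos r)) (.r (.inv r)) ∧ le (.r (.inv r)) (.r (.pos r)))

/-- There is a chain `α₀ ≺ α₁ ≺ ⋯ ≺ α_k = α` (with `k` strict steps). -/
def ChainTo (le : DLSym γ ρ → DLSym γ ρ → Prop) (k : ℕ) (α : DLSym γ ρ) : Prop :=
  ∃ f : ℕ → DLSym γ ρ, f k = α ∧ ∀ i < k, StrictOf le (f i) (f (i + 1))

/-- The height of a symbol: length of the longest strict chain ending in it. -/
def SymHeight (le : DLSym γ ρ → DLSym γ ρ → Prop) (α : DLSym γ ρ) (n : ℕ) : Prop :=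
  ChainTo le n α ∧ ∀ m, ChainTo le m α → m ≤ n

/-- Height of a concept: `⊤, ⊥` have height 0, otherwise max over the symbols occurring. -/
inductive ConcHeight (le : DLSym γ ρ → DLSym γ ρ → Prop) : DLConcept γ ρ → ℕ → Prop
  | top : ConcHeight le .top 0
  | bot : ConcHeight le .bot 0
  | name {A : γ} {n : ℕ} : SymHeight le (.c A) n → ConcHeight le (.name A) n
  | conj {C D : DLConcept γ ρ} {m k : ℕ} :
      ConcHeight le C m → ConcHeight le D k → ConcHeight le (.conj C D) (max m k)
  | ex {s : DLRole ρ} {C : DLConcept γ ρ} {m k : ℕ} :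
      SymHeight le (.r s) m → ConcHeight le C k → ConcHeight le (.ex s C) (max m k)

def ConcHeightLe (le : DLSym γ ρ → DLSym γ ρ → Prop) (C : DLConcept γ ρ) (n : ℕ) : Prop :=
  ∃ m ≤ n, ConcHeight le C m

/-- `T↾n`: the GCIs of `T` that solely involve concepts of height at most `n`. -/
def TRestrict (T : Set (DLGCI γ ρ)) (le : DLSym γ ρ → DLSym γ ρ → Prop) (n : ℕ) :
    Set (DLGCI γ ρ) :=
  {g ∈ T | ConcHeightLe le g.lhs n ∧ ConcHeightLe le g.rhs n}

/-- Subconcepts. -/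
def DLConcept.sub : DLConcept γ ρ → Set (DLConcept γ ρ)
  | .bot => {DLConcept.bot}
  | .top => {DLConcept.top}
  | .name A => {DLConcept.name A}
  | .conj C D => insert (DLConcept.conj C D) (C.sub ∪ D.sub)
  | .ex s C => insert (DLConcept.ex s C) C.sub

/-- `con(T)`: atomic concepts occurring in `T`, together with `⊤` and `⊥`. -/
def ConOf (T : Set (DLGCI γ ρ)) : Set (DLConcept γ ρ) :=
  {C | C = .top ∨ C = .bot ∨
    (C.Atomic ∧ ∃ g ∈ T, C ∈ g.lhs.sub ∪ g.rhs.sub)}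

/-- Individual names occurring in an ABox. -/
def indsOf (AB : Set (DLAssertion γ ρ ι)) : Set ι :=
  {a | (∃ C, DLAssertion.conc C a ∈ AB) ∨ (∃ s b, DLAssertion.role s a b ∈ AB) ∨
    (∃ s b, DLAssertion.role s b a ∈ AB)}

/-- A (possibly inverted) role edge recorded in the ABox. -/
def roleIn (AB : Set (DLAssertion γ ρ ι)) (s : DLRole ρ) (a b : ι) : Prop :=
  DLAssertion.role s a b ∈ AB ∨ DLAssertion.role s.flip b a ∈ AB

/-- `C(a)` holds in the ABox; `⊤(a)` abbreviates that `a` occurs in the ABox. -/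
def concIn (AB : Set (DLAssertion γ ρ ι)) (C : DLConcept γ ρ) (a : ι) : Prop :=
  DLAssertion.conc C a ∈ AB ∨ (C = DLConcept.top ∧ a ∈ indsOf AB)

/-- ABoxes are finite and only assert atomic concepts. -/
def IsABox (AB : Set (DLAssertion γ ρ ι)) : Prop :=
  AB.Finite ∧ ∀ (C : DLConcept γ ρ) (a : ι), DLAssertion.conc C a ∈ AB → C.Atomic

/-- The interpretation given by an ABox (viewed as a graph database). -/
def abInterp [Nonempty ι] (AB : Set (DLAssertion γ ρ ι)) : DLInterp γ ρ ι where
  Dom := ι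
  inh := inferInstance
  iInd := id
  iC := fun A => {a | DLAssertion.conc (DLConcept.name A) a ∈ AB}
  iR := fun r => {p | roleIn AB (DLRole.pos r) p.1 p.2}

/-! ### The constructed nested automata `𝔄_A` (Definitions 3 and 4 of the paper) -/

/-- States of the constructed automata: a premise (set of concepts) and a goal. -/
abbrev AState (γ ρ : Type) := Set (DLConcept γ ρ) × DLConcept γ ρ

/-- Letters of the constructed automata: roles, concept tests and automaton tests. -/
inductive ALetter (γ ρ : Type) : Type
  | role (s : DLRole ρ)
  | ctest (C : DLConcept γ ρ)
  | atest (B : γ)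

def initState (A : γ) : AState γ ρ := ({DLConcept.top}, DLConcept.name A)

def finalA (q : AState γ ρ) : Prop := q.2 ∈ q.1 ∨ DLConcept.bot ∈ q.1

/-- The transition relation of the automaton `𝔄_A` at nesting level `n`
(Definitions 3 and 4 of the paper). -/
inductive ATrans (T : Set (DLGCI γ ρ)) (le : DLSym γ ρ → DLSym γ ρ → Prop) (n : ℕ) :
    AState γ ρ → ALetter γ ρ → AState γ ρ → Prop
  | weak {p : Set (DLConcept γ ρ)} {g : DLConcept γ ρ} (p' : Set (DLConcept γ ρ)) :
      p' ⊆ p →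
      ATrans T le n (p, g) (.ctest .top) (insert DLConcept.top p', g)
  | data {p : Set (DLConcept γ ρ)} {g : DLConcept γ ρ} (B : γ) :
      DLConcept.name B ∈ ConOf (TRestrict T le n) →
      ATrans T le n (p, g) (.ctest (.name B)) (insert (DLConcept.name B) p, g)
  | sbus {p : Set (DLConcept γ ρ)} {C D : DLConcept γ ρ} :
      (⟨C, D⟩ : DLGCI γ ρ) ∈ TRestrict T le n → C.Atomic → D.Atomic →
      ATrans T le n (p, D) (.ctest .top) (p, C)
  | succ {p : Set (DLConcept γ ρ)} {s : DLRole ρ} {C D : DLConcept γ ρ} :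
      (⟨.ex s C, D⟩ : DLGCI γ ρ) ∈ TRestrict T le n →
      ATrans T le n (p, D) (.role s) ({DLConcept.top}, C)
  | anon {p : Set (DLConcept γ ρ)} {B D : DLConcept γ ρ} :
      B ∈ ConOf (TRestrict T le n) → D ∈ ConOf (TRestrict T le n) →
      DLEntails ((fun C => DLAssertion.conc C ()) '' insert B p) (TRestrict T le n)
        (DLAssertion.conc D ()) →
      ATrans T le n (p, D) (.ctest .top) (p, B)
  | nocl {p : Set (DLConcept γ ρ)} {B C D : γ} : 0 < n →
      (⟨.conj (.name B) (.name C), .name D⟩ : DLGCI γ ρ) ∈ TRestrict T le n →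
      DLConcept.name B ∈ p →
      ATrans T le n (p, .name D) (.ctest .top) (p, .name C)
  | nocr {p : Set (DLConcept γ ρ)} {B C D : γ} : 0 < n →
      (⟨.conj (.name C) (.name B), .name D⟩ : DLGCI γ ρ) ∈ TRestrict T le n →
      DLConcept.name B ∈ p →
      ATrans T le n (p, .name D) (.ctest .top) (p, .name C)
  | aut {p : Set (DLConcept γ ρ)} {g : DLConcept γ ρ} (B : γ) : 0 < n →
      DLConcept.name B ∈ ConOf (TRestrict T le (n - 1)) →
      (∃ m < n, SymHeight le (.c B) m) →
      ATrans T le n (p, g) (.atest B) (insert (DLConcept.name B) p, g)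

/-- Reachability by runs of the constructed automata over an interpretation `I`:
`AReach T le I n q d q' d'` holds if the level-`n` automaton can go from state `q`
at element `d` to state `q'` at element `d'`.  An automaton test `𝔄_B?` requires an
accepting run of the automaton for `B` (at the level given by the height of `B`). -/
inductive AReach (T : Set (DLGCI γ ρ)) (le : DLSym γ ρ → DLSym γ ρ → Prop)
    (I : DLInterp γ ρ ι) : ℕ → AState γ ρ → I.Dom → AState γ ρ → I.Dom → Prop
  | refl (n : ℕ) (q : AState γ ρ) (d : I.Dom) : AReach T le I n q d q d
  | role {n : ℕ} {q : AState γ ρ} {d : I.Dom} {q' : AState γ ρ} {d' : I.Dom}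
      {q'' : AState γ ρ} {d'' : I.Dom} {s : DLRole ρ} :
      AReach T le I n q d q' d' → ATrans T le n q' (.role s) q'' →
      (d', d'') ∈ I.role s → AReach T le I n q d q'' d''
  | ctest {n : ℕ} {q : AState γ ρ} {d : I.Dom} {q' : AState γ ρ} {d' : I.Dom}
      {q'' : AState γ ρ} {C : DLConcept γ ρ} :
      AReach T le I n q d q' d' → ATrans T le n q' (.ctest C) q'' →
      d' ∈ I.conc C → AReach T le I n q d q'' d'
  | atest {n : ℕ} {q : AState γ ρ} {d : I.Dom} {q' : AState γ ρ} {d' : I.Dom}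
      {q'' : AState γ ρ} {B : γ} {m : ℕ} {p : AState γ ρ} {e : I.Dom} :
      AReach T le I n q d q' d' → ATrans T le n q' (.atest B) q'' →
      SymHeight le (.c B) m →
      AReach T le I m (initState B) d' p e → finalA p →
      AReach T le I n q d q'' d'

/-- There is an accepting run of the level-`n` automaton `𝔄_A` starting from `d`. -/
def AAccept (T : Set (DLGCI γ ρ)) (le : DLSym γ ρ → DLSym γ ρ → Prop)
    (I : DLInterp γ ρ ι) (n : ℕ) (A : γ) (d : I.Dom) : Prop :=
  ∃ q e, AReach T le I n (initState A) d q e ∧ finalA q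

/-- An explicit run `ρ₁ ⋯ ρ_ℓ` of the level-`n` automaton over `I`, given by its
elements `d i`, states `q i` and letters `w i`. -/
structure ARun (T : Set (DLGCI γ ρ)) (le : DLSym γ ρ → DLSym γ ρ → Prop)
    (I : DLInterp γ ρ ι) (n ℓ : ℕ) where
  d : ℕ → I.Dom
  q : ℕ → AState γ ρ
  w : ℕ → ALetter γ ρ
  htrans : ∀ i < ℓ, ATrans T le n (q i) (w i) (q (i + 1))
  hrole : ∀ i < ℓ, ∀ s : DLRole ρ, w i = .role s → (d i, d (i + 1)) ∈ I.role s
  hctest : ∀ i < ℓ, ∀ C : DLConcept γ ρ, w i = .ctest C →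
      d i = d (i + 1) ∧ d i ∈ I.conc C
  hatest : ∀ i < ℓ, ∀ B : γ, w i = .atest B → d i = d (i + 1) ∧
      ∃ m, SymHeight le (.c B) m ∧ AAccept T le I m B (d i)

/-! ### Generic nested two-way regular path automata (n-nested NFAs) -/

/-- Letters of a generic nested automaton: roles, concept tests, and tests referring
to the `j`-th automaton of a system. -/
inductive GLetter (γ ρ : Type) : Type
  | role (s : DLRole ρ)
  | ctest (C : DLConcept γ ρ)
  | atest (j : ℕ)

/-- A system of nested automata with state space `Q`: automaton `k` is `k`-nested,
i.e. its automaton tests only refer to automata of strictly smaller index, and all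
concept tests are over atomic concepts. -/
structure AutoSys (γ ρ : Type) (Q : Type) where
  δ : ℕ → Q → GLetter γ ρ → Q → Prop
  init : ℕ → Q
  final : ℕ → Q → Prop
  nested : ∀ k q j q', δ k q (.atest j) q' → j < k
  testsAtomic : ∀ k q (C : DLConcept γ ρ) q', δ k q (.ctest C) q' → C.Atomic

/-- Reachability by runs of the automata of a system over an interpretation. -/
inductive GReach {Q : Type} (S : AutoSys γ ρ Q) (I : DLInterp γ ρ ι) :
    ℕ → Q → I.Dom → Q → I.Dom → Prop
  | refl (k : ℕ) (q : Q) (d : I.Dom) : GReach S I k q d q d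
  | role {k : ℕ} {q : Q} {d : I.Dom} {q' : Q} {d' : I.Dom} {q'' : Q} {d'' : I.Dom}
      {s : DLRole ρ} :
      GReach S I k q d q' d' → S.δ k q' (.role s) q'' → (d', d'') ∈ I.role s →
      GReach S I k q d q'' d''
  | ctest {k : ℕ} {q : Q} {d : I.Dom} {q' : Q} {d' : I.Dom} {q'' : Q}
      {C : DLConcept γ ρ} :
      GReach S I k q d q' d' → S.δ k q' (.ctest C) q'' → d' ∈ I.conc C →
      GReach S I k q d q'' d'
  | atest {k : ℕ} {q : Q} {d : I.Dom} {q' : Q} {d' : I.Dom} {q'' : Q} {j : ℕ}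
      {p : Q} {e : I.Dom} :
      GReach S I k q d q' d' → S.δ k q' (.atest j) q'' →
      GReach S I j (S.init j) d' p e → S.final j p →
      GReach S I k q d q'' d'

/-- Acceptance for the `k`-th automaton of a system, starting from `d`. -/
def GAccept {Q : Type} (S : AutoSys γ ρ Q) (I : DLInterp γ ρ ι) (k : ℕ)
    (d : I.Dom) : Prop :=
  ∃ q e, GReach S I k (S.init k) d q e ∧ S.final k q

/-! ### Derivations (Definition 5 of the paper) -/

/-- A derivation step `AB ⇝_T AB'` applying a GCI (`none` for the `⊥`-rule), recording
the GCI used, the premise assertion `used` and the newly added assertion `added`. -/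
inductive DStep (T : Set (DLGCI γ ρ)) (tgt : DLAssertion γ ρ ι) :
    Option (DLGCI γ ρ) → DLAssertion γ ρ ι → DLAssertion γ ρ ι →
    Set (DLAssertion γ ρ ι) → Set (DLAssertion γ ρ ι) → Prop
  | sub {AB : Set (DLAssertion γ ρ ι)} {B C : DLConcept γ ρ} {b : ι} :
      (⟨B, C⟩ : DLGCI γ ρ) ∈ T → B.AtomNB → C.AtomNB → concIn AB B b →
      DStep T tgt (some ⟨B, C⟩) (.conc B b) (.conc C b) AB (insert (.conc C b) AB)
  | conj₁ {AB : Set (DLAssertion γ ρ ι)} {B₁ B₂ C : DLConcept γ ρ} {b : ι} :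
      (⟨.conj B₁ B₂, C⟩ : DLGCI γ ρ) ∈ T → concIn AB B₁ b → concIn AB B₂ b →
      DStep T tgt (some ⟨.conj B₁ B₂, C⟩) (.conc B₁ b) (.conc C b) AB
        (insert (.conc C b) AB)
  | conj₂ {AB : Set (DLAssertion γ ρ ι)} {B₁ B₂ C : DLConcept γ ρ} {b : ι} :
      (⟨.conj B₁ B₂, C⟩ : DLGCI γ ρ) ∈ T → concIn AB B₁ b → concIn AB B₂ b →
      DStep T tgt (some ⟨.conj B₁ B₂, C⟩) (.conc B₂ b) (.conc C b) AB
        (insert (.conc C b) AB)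
  | exR {AB : Set (DLAssertion γ ρ ι)} {B : DLConcept γ ρ} {s : DLRole ρ}
      {C₁ : DLConcept γ ρ} {b c : ι} :
      (⟨B, .ex s C₁⟩ : DLGCI γ ρ) ∈ T → B.AtomNB → concIn AB B b → c ∉ indsOf AB →
      DStep T tgt (some ⟨B, .ex s C₁⟩) (.conc B b) (.conc C₁ c) AB
        (insert (.role s b c) (insert (.conc C₁ c) AB))
  | exL {AB : Set (DLAssertion γ ρ ι)} {B₁ : DLConcept γ ρ} {s : DLRole ρ}
      {C : DLConcept γ ρ} {b c : ι} :
      (⟨.ex s B₁, C⟩ : DLGCI γ ρ) ∈ T → roleIn AB s b c → concIn AB B₁ c →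
      DStep T tgt (some ⟨.ex s B₁, C⟩) (.conc B₁ c) (.conc C b) AB
        (insert (.conc C b) AB)
  | bot {AB : Set (DLAssertion γ ρ ι)} {b : ι} :
      DLAssertion.conc DLConcept.bot b ∈ AB →
      DStep T tgt none (.conc .bot b) tgt AB {tgt}

/-- `seq 0, …, seq n` is a `T`-derivation of `tgt` from the ABox `AB`. -/
def IsDeriv (T : Set (DLGCI γ ρ)) (tgt : DLAssertion γ ρ ι)
    (AB : Set (DLAssertion γ ρ ι)) (seq : ℕ → Set (DLAssertion γ ρ ι)) (n : ℕ) : Prop :=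
  seq 0 ⊆ AB ∧ tgt ∈ seq n ∧
    ∀ i < n, ∃ og u ad, DStep T tgt og u ad (seq i) (seq (i + 1))

/-- `tgt` is `T`-derivable from `AB`. -/
def Derivable (T : Set (DLGCI γ ρ)) (tgt : DLAssertion γ ρ ι)
    (AB : Set (DLAssertion γ ρ ι)) : Prop :=
  ∃ n seq, IsDeriv T tgt AB seq n

/-- A `(T, ℓ)`-derivation from `AB` of length `n`: a sequence of ABoxes `Ab i`
paired with active instance queries `(qc i)(qa i)` (concepts of `T↾ℓ` of height at
most `ℓ`), every prefix being a `T↾ℓ`-derivation of the corresponding active query,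
with recorded step information and the stratification condition on steps applying a
GCI whose right-hand side has height `ℓ`. -/
structure StratDeriv (T : Set (DLGCI γ ρ)) (le : DLSym γ ρ → DLSym γ ρ → Prop)
    (ℓ : ℕ) (AB : Set (DLAssertion γ ρ ι)) (n : ℕ) where
  Ab : ℕ → Set (DLAssertion γ ρ ι)
  qc : ℕ → DLConcept γ ρ
  qa : ℕ → ι
  og : ℕ → Option (DLGCI γ ρ)
  used : ℕ → DLAssertion γ ρ ι
  added : ℕ → DLAssertion γ ρ ι
  hstart : Ab 0 ⊆ AB
  hactive : ∀ i ≤ n, qc i ∈ ConOf (TRestrict T le ℓ) ∧ ConcHeightLe le (qc i) ℓ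
  hstep : ∀ i < n,
      DStep (TRestrict T le ℓ) (DLAssertion.conc (qc (i + 1)) (qa (i + 1)))
        (og i) (used i) (added i) (Ab i) (Ab (i + 1))
  hderiv : ∀ i ≤ n, concIn (Ab i) (qc i) (qa i) ∧
      ∀ j < i, ∃ og' u' ad',
        DStep (TRestrict T le ℓ) (DLAssertion.conc (qc i) (qa i)) og' u' ad'
          (Ab j) (Ab (j + 1))
  hstrat : ∀ i < n, ∀ g : DLGCI γ ρ, og i = some g → ConcHeight le g.rhs ℓ →
      (∀ B' : γ, DLConcept.name B' ∈ g.lhs.sub → SymHeight le (.c B') ℓ →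
        qc i = .name B') ∧
      (∀ B'' : γ, DLConcept.name B'' ∈ g.rhs.sub → qc (i + 1) = .name B'')

/-- The restriction of an ABox to concept assertions about `a` whose concepts have
height at most `m`. -/
def ARestrictAt (le : DLSym γ ρ → DLSym γ ρ → Prop) (AB : Set (DLAssertion γ ρ ι))
    (a : ι) (m : ℕ) : Set (DLAssertion γ ρ ι) :=
  {α | ∃ C : DLConcept γ ρ, α = DLAssertion.conc C a ∧ α ∈ AB ∧ ConcHeightLe le C m}

/-- The invariant carried along runs: an element satisfying the premise satisfies the goal. -/
def DLInterp.Sound (I : DLInterp γ ρ ι) (q : AState γ ρ) (d : I.Dom) : Prop :=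
  (∀ C ∈ q.1, d ∈ I.conc C) → d ∈ I.conc q.2

/-- Semantics of the letters, automaton tests for `B` being read as concept tests for `B`. -/
def DLInterp.letter (I : DLInterp γ ρ ι) : ALetter γ ρ → I.Dom → I.Dom → Prop
  | .role s, d, e => (d, e) ∈ I.role s
  | .ctest C, d, e => d = e ∧ d ∈ I.conc C
  | .atest B, d, e => d = e ∧ d ∈ I.conc (.name B)

/-- The interpretation `I` with the single individual name `()` interpreted by `d`. -/
def DLInterp.pointed (I : DLInterp γ ρ ι) (d : I.Dom) : DLInterp γ ρ Unit :=
  ⟨I.Dom, I.inh, fun _ => d, I.iC, I.iR⟩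

theorem DLInterp.pointed_role (I : DLInterp γ ρ ι) (d : I.Dom) (s : DLRole ρ) :
    (I.pointed d).role s = I.role s := by
  cases s <;> rfl

theorem DLInterp.pointed_conc (I : DLInterp γ ρ ι) (d : I.Dom) (C : DLConcept γ ρ) :
    (I.pointed d).conc C = I.conc C := by
  induction C with
  | bot => rfl
  | top => rfl
  | name A => rfl
  | conj C D hC hD => simp only [DLInterp.conc, hC, hD]; rfl
  | ex s C hC => simp only [DLInterp.conc, hC, DLInterp.pointed_role]; rfl

theorem DLInterp.mem_conc_of_entails (I : DLInterp γ ρ ι) {T : Set (DLGCI γ ρ)}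
    (hT : ∀ g ∈ T, I.satG g) {p : Set (DLConcept γ ρ)} {D : DLConcept γ ρ}
    (h : DLEntails ((fun C => DLAssertion.conc C ()) '' p) T (DLAssertion.conc D ()))
    {d : I.Dom} (hd : ∀ C ∈ p, d ∈ I.conc C) : d ∈ I.conc D := by
  rw [← I.pointed_conc d D]
  refine h (I.pointed d) ⟨?_, fun g hg => ?_⟩
  · rintro _ ⟨C, hC, rfl⟩
    change d ∈ (I.pointed d).conc C
    rw [I.pointed_conc]
    exact hd C hC
  · unfold DLInterp.satG
    rw [I.pointed_conc, I.pointed_conc]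
    exact hT g hg

theorem ATrans.sound {T : Set (DLGCI γ ρ)} {le : DLSym γ ρ → DLSym γ ρ → Prop} {n : ℕ}
    {I : DLInterp γ ρ ι} (hT : ∀ g ∈ T, I.satG g) {q q' : AState γ ρ} {w : ALetter γ ρ}
    (h : ATrans T le n q w q') {d d' : I.Dom} (hw : I.letter w d d') (hs : I.Sound q' d') :
    I.Sound q d := by
  intro hp
  cases h with
  | weak p' hsub =>
    obtain ⟨rfl, -⟩ := hw
    exact hs (Set.forall_mem_insert.2 ⟨trivial, fun C hC => hp C (hsub hC)⟩)
  | data B _ =>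
    obtain ⟨rfl, hB⟩ := hw
    exact hs (Set.forall_mem_insert.2 ⟨hB, hp⟩)
  | sbus hg _ _ =>
    obtain ⟨rfl, -⟩ := hw
    exact hT _ hg.1 (hs hp)
  | succ hg =>
    exact hT _ hg.1 ⟨d', hw, hs (by rintro _ rfl; trivial)⟩
  | anon _ _ he =>
    obtain ⟨rfl, -⟩ := hw
    exact I.mem_conc_of_entails (fun g hg => hT g hg.1) he
      (Set.forall_mem_insert.2 ⟨hs hp, hp⟩)
  | nocl _ hg hB =>
    obtain ⟨rfl, -⟩ := hw
    exact hT _ hg.1 ⟨hp _ hB, hs hp⟩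
  | nocr _ hg hB =>
    obtain ⟨rfl, -⟩ := hw
    exact hT _ hg.1 ⟨hs hp, hp _ hB⟩
  | aut B _ _ _ =>
    obtain ⟨rfl, hB⟩ := hw
    exact hs (Set.forall_mem_insert.2 ⟨hB, hp⟩)

theorem finalA.sound {q : AState γ ρ} (h : finalA q) (I : DLInterp γ ρ ι) (d : I.Dom) :
    I.Sound q d :=
  fun hp => h.elim (hp _) fun hb => (hp _ hb).elim

theorem DLInterp.sound_initState {I : DLInterp γ ρ ι} {A : γ} {d : I.Dom}
    (h : I.Sound (initState A) d) : d ∈ I.conc (.name A) :=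
  h (by rintro _ rfl; trivial)

theorem AReach.sound {T : Set (DLGCI γ ρ)} {le : DLSym γ ρ → DLSym γ ρ → Prop} {n : ℕ}
    {I : DLInterp γ ρ ι} (hT : ∀ g ∈ T, I.satG g) {q q' : AState γ ρ} {d d' : I.Dom}
    (h : AReach T le I n q d q' d') : I.Sound q' d' → I.Sound q d := by
  induction h with
  | refl => exact id
  | role _ ht hr ih => exact fun hs => ih (ht.sound hT hr hs)
  | ctest _ ht hc ih => exact fun hs => ih (ht.sound hT ⟨rfl, hc⟩ hs)
  | atest _ ht _ _ hf ih ihB =>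
    exact fun hs => ih (ht.sound hT ⟨rfl, DLInterp.sound_initState (ihB (hf.sound I _))⟩ hs)

theorem AAccept.mem_conc {T : Set (DLGCI γ ρ)} {le : DLSym γ ρ → DLSym γ ρ → Prop} {n : ℕ}
    {I : DLInterp γ ρ ι} (hT : ∀ g ∈ T, I.satG g) {A : γ} {d : I.Dom}
    (h : AAccept T le I n A d) : d ∈ I.conc (.name A) := by
  obtain ⟨q, e, hr, hf⟩ := h
  exact DLInterp.sound_initState (hr.sound hT (hf.sound I e))

theorem ARun.letter {T : Set (DLGCI γ ρ)} {le : DLSym γ ρ → DLSym γ ρ → Prop} {n ℓ : ℕ}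
    {I : DLInterp γ ρ ι} (hT : ∀ g ∈ T, I.satG g) (R : ARun T le I n ℓ) {i : ℕ} (hi : i < ℓ) :
    I.letter (R.w i) (R.d i) (R.d (i + 1)) := by
  cases hw : R.w i with
  | role s => exact R.hrole i hi s hw
  | ctest C => exact R.hctest i hi C hw
  | atest B =>
    obtain ⟨hd, m, -, hB⟩ := R.hatest i hi B hw
    exact ⟨hd, hB.mem_conc hT⟩

/-- the key invariant in the proof of Lemma 5.  Let `I` be a model
of `(AB, T)` and `ρ` an accepting run of `𝔄_A` in `I` of length `ℓ` starting from
`a^I`.  Then for every index `i ≤ ℓ`: if `ρ.d i` satisfies in `I` all concepts of the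
premise of `ρ.q i`, then it also satisfies the goal of `ρ.q i`. -/
theorem stmt2
    (T : Set (DLGCI ℕ ℕ)) (le : DLSym ℕ ℕ → DLSym ℕ ℕ → Prop)
    (hfin : T.Finite) (hnf : NormalTBox T) (hstrat : StratifiedWith T le)
    (AB : Set (DLAssertion ℕ ℕ ℕ)) (hAB : IsABox AB)
    (I : DLInterp ℕ ℕ ℕ) (hI : DLModels I AB T)
    (A : ℕ) (n : ℕ) (hheight : SymHeight le (DLSym.c A) n)
    (a : ℕ) (ℓ : ℕ) (ρ : ARun T le I n ℓ)
    (hq0 : ρ.q 0 = initState A) (hd0 : ρ.d 0 = I.iInd a)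
    (hacc : finalA (ρ.q ℓ)) :
    ∀ i ≤ ℓ, (∀ C ∈ (ρ.q i).1, ρ.d i ∈ I.conc C) → ρ.d i ∈ I.conc (ρ.q i).2 := by
  intro i hi
  induction hi using Nat.decreasingInduction with
  | self => exact hacc.sound I _
  | of_succ i hi ih => exact (ρ.htrans i hi).sound hI.2 (ρ.letter hI.2 hi) ih
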